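/- Let G be a countable amenable group with Følner sequence (F_n), e ∈ F_n for all n. Let E_1 ⊆ E_2 ⊆ … ⊆ E_k be finite subsets of G containing e, and let C_1, …, C_k ⊆ G be such that the tiles E_i c (for 1 ≤ i ≤ k, c ∈ C_i) are pairwise disjoint. Let E = ∪_{i=1}^k E_i C_i. Suppose E'_i ⊆ E_i with |E'_i| > (1−γ)|E_i| for each i, where 0 < γ < 1, and set E' = ∪_{i=1}^k E'_i C_i. Then the lower Banach densities satisfy D(E) − D(E') < γ; in fact D(E') ≥ (1−γ)D(E). -/

import Mathlib

open scoped Pointwise Classical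
open Filter

/-- `F` is a Følner sequence for the countable group `G`. -/
def IsFolnerSeq {G : Type*} [Group G] (F : ℕ → Finset G) : Prop :=
  (∀ n, (F n).Nonempty) ∧
  ∀ g : G, Tendsto (fun n => ((symmDiff (F n) ((F n).image (g * ·))).card : ℝ) / (F n).card)
    atTop (nhds 0)

/-- `D_F(H) = inf_{g ∈ G} |H ∩ Fg| / |F|`. -/
noncomputable def lowerDF {G : Type*} [Group G] (F : Finset G) (H : Set G) : ℝ :=
  ⨅ g : G, (Set.ncard (H ∩ ((· * g) '' (F : Set G))) : ℝ) / (F.card : ℝ)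

/-- The lower Banach density `D(H) = sup {D_F(H) : F ⊆ G finite nonempty}`. -/
noncomputable def banachDensity {G : Type*} [Group G] (H : Set G) : ℝ :=
  ⨆ F : {F : Finset G // F.Nonempty}, lowerDF F.1 H

/-- The elements of `A` that left multiplication by `t` moves out of `A`. -/
noncomputable def exitSet {G : Type*} [Group G] (A : Finset G) (t : G) : Finset G :=
  A.filter (fun a => t * a ∉ A)

lemma card_exitSet_le_card_symmDiff {G : Type*} [Group G] (A : Finset G) (t : G) :
    (exitSet A t).card ≤ (symmDiff A (A.image (t * ·))).card := by
  rw [← Finset.card_image_of_injective (exitSet A t) (mul_right_injective t)]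
  apply Finset.card_le_card
  intro x hx
  obtain ⟨a, ha, rfl⟩ := Finset.mem_image.1 hx
  obtain ⟨haA, hta⟩ := Finset.mem_filter.1 ha
  exact Finset.mem_symmDiff.2 (Or.inr ⟨Finset.mem_image_of_mem _ haA, hta⟩)

lemma card_exitSet_image_mul_right {G : Type*} [Group G] (A : Finset G) (t g : G) :
    (exitSet (A.image (· * g)) t).card = (exitSet A t).card := by
  have h : exitSet (A.image (· * g)) t = (exitSet A t).image (· * g) := by
    unfold exitSet
    rw [Finset.filter_image]
    congr 1
    apply Finset.filter_congr
    intro a _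
    simp [← mul_assoc]
  rw [h, Finset.card_image_of_injective _ (mul_left_injective g)]

lemma IsFolnerSeq.eventually_sum_card_exitSet_le {G : Type*} [Group G] {Fo : ℕ → Finset G}
    (hFo : IsFolnerSeq Fo) (T : Finset G) {ε : ℝ} (hε : 0 < ε) :
    ∀ᶠ n in atTop, (∑ t ∈ T, ((exitSet (Fo n) t).card : ℝ)) ≤ ε * (Fo n).card := by
  have h : Tendsto (fun n => ∑ t ∈ T,
      ((symmDiff (Fo n) ((Fo n).image (t * ·))).card : ℝ) / (Fo n).card) atTop (nhds 0) := by
    simpa using tendsto_finsetSum T (fun t _ => hFo.2 t)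
  filter_upwards [h.eventually (gt_mem_nhds hε)] with n hn
  have hpos : (0 : ℝ) < (Fo n).card := by exact_mod_cast (hFo.1 n).card_pos
  rw [← Finset.sum_div, div_lt_iff₀ hpos] at hn
  refine le_trans (Finset.sum_le_sum fun t _ => ?_) hn.le
  exact_mod_cast card_exitSet_le_card_symmDiff (Fo n) t

lemma ncard_inter_image_mul_right {G : Type*} [Group G] (F : Finset G) (H : Set G) (g : G) :
    Set.ncard (H ∩ ((· * g) '' (F : Set G))) = (F.filter (fun f => f * g ∈ H)).card := by
  rw [← Finset.card_image_of_injective _ (mul_left_injective g), ← Set.ncard_coe_finset]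
  congr 1
  ext x
  simp only [Set.mem_inter_iff, Set.mem_image, Finset.coe_image, Finset.coe_filter,
    Set.mem_ofPred_eq, Finset.mem_coe]
  constructor
  · rintro ⟨hx, f, hf, rfl⟩
    exact ⟨f, ⟨hf, hx⟩, rfl⟩
  · rintro ⟨f, ⟨hf, hx⟩, rfl⟩
    exact ⟨hx, f, hf, rfl⟩

lemma lowerDF_le {G : Type*} [Group G] (F : Finset G) (H : Set G) (g : G) :
    lowerDF F H ≤ ((F.filter (fun f => f * g ∈ H)).card : ℝ) / F.card := by
  rw [← ncard_inter_image_mul_right]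
  exact ciInf_le ⟨0, by rintro _ ⟨g, rfl⟩; positivity⟩ g

lemma le_lowerDF {G : Type*} [Group G] (F : Finset G) (H : Set G) {r : ℝ}
    (h : ∀ g : G, r ≤ ((F.filter (fun f => f * g ∈ H)).card : ℝ) / F.card) :
    r ≤ lowerDF F H := by
  refine le_ciInf fun g => ?_
  rw [ncard_inter_image_mul_right]
  exact h g

lemma lowerDF_le_one {G : Type*} [Group G] (F : Finset G) (H : Set G) : lowerDF F H ≤ 1 := by
  refine (lowerDF_le F H 1).trans (div_le_one_of_le₀ ?_ (by positivity))
  exact_mod_cast Finset.card_filter_le _ _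

lemma lowerDF_le_banachDensity {G : Type*} [Group G] {F : Finset G} (hF : F.Nonempty)
    (H : Set G) : lowerDF F H ≤ banachDensity H :=
  le_ciSup (f := fun F : {F : Finset G // F.Nonempty} => lowerDF F.1 H)
    ⟨1, by rintro _ ⟨F, rfl⟩; exact lowerDF_le_one F.1 H⟩ ⟨F, hF⟩

lemma banachDensity_le {G : Type*} [Group G] {H : Set G} {r : ℝ}
    (h : ∀ F : Finset G, F.Nonempty → lowerDF F H ≤ r) : banachDensity H ≤ r :=
  haveI : Nonempty {F : Finset G // F.Nonempty} := ⟨⟨{1}, Finset.singleton_nonempty 1⟩⟩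
  ciSup_le fun F => h F.1 F.2

/-- Averaging the count of `H` in `F a g` over `a ∈ A` bounds `D_F(H)` by the frequency of `H`
in `A g`, up to the failure of `A` to be invariant under `F`. -/
lemma lowerDF_mul_card_le {G : Type*} [Group G] {F : Finset G} (hF : F.Nonempty)
    (A : Finset G) (H : Set G) (g : G) :
    lowerDF F H * A.card ≤
      (A.filter (fun a => a * g ∈ H)).card + ∑ f ∈ F, ((exitSet A f).card : ℝ) := by
  have hFpos : (0 : ℝ) < F.card := by exact_mod_cast hF.card_pos
  have hF1 : (1 : ℝ) ≤ F.card := by exact_mod_cast hF.card_pos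
  have hlow : lowerDF F H * A.card * F.card ≤
      ∑ a ∈ A, ((F.filter (fun f => f * (a * g) ∈ H)).card : ℝ) := by
    have h : ∑ _a ∈ A, lowerDF F H * F.card ≤
        ∑ a ∈ A, ((F.filter (fun f => f * (a * g) ∈ H)).card : ℝ) :=
      Finset.sum_le_sum fun a _ => (le_div_iff₀ hFpos).1 (lowerDF_le F H (a * g))
    rw [Finset.sum_const, nsmul_eq_mul] at h
    linarith
  have hswap : ∑ a ∈ A, (F.filter (fun f => f * (a * g) ∈ H)).card =
      ∑ f ∈ F, (A.filter (fun a => f * (a * g) ∈ H)).card :=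
    Finset.sum_card_bipartiteAbove_eq_sum_card_bipartiteBelow (fun a f => f * (a * g) ∈ H)
  have hup : ∀ f : G, (A.filter (fun a => f * (a * g) ∈ H)).card ≤
      (A.filter (fun a => a * g ∈ H)).card + (exitSet A f).card := by
    intro f
    rw [← Finset.card_image_of_injective (A.filter (fun a => a * g ∈ H))
      (mul_right_injective f⁻¹)]
    refine (Finset.card_le_card ?_).trans (Finset.card_union_le _ _)
    intro a ha
    obtain ⟨haA, haH⟩ := Finset.mem_filter.1 ha
    by_cases hfa : f * a ∈ A
    · refine Finset.mem_union_left _ (Finset.mem_image.2 ⟨f * a, ?_, by simp⟩)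
      exact Finset.mem_filter.2 ⟨hfa, by rwa [mul_assoc]⟩
    · exact Finset.mem_union_right _ (Finset.mem_filter.2 ⟨haA, hfa⟩)
  have hsum : (∑ a ∈ A, ((F.filter (fun f => f * (a * g) ∈ H)).card : ℝ)) ≤
      F.card * (A.filter (fun a => a * g ∈ H)).card + ∑ f ∈ F, ((exitSet A f).card : ℝ) := by
    have h := Finset.sum_le_sum fun f (_ : f ∈ F) => hup f
    rw [← hswap, Finset.sum_add_distrib, Finset.sum_const, smul_eq_mul] at h
    exact_mod_cast h
  have hexit : (0 : ℝ) ≤ ∑ f ∈ F, ((exitSet A f).card : ℝ) := by positivity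
  refine le_of_mul_le_mul_right ?_ hFpos
  nlinarith [mul_nonneg hexit (sub_nonneg.2 hF1)]

/-- In a finite window `B`, shrinking disjoint tiles by a factor at least `r` shrinks the number of
covered points by a factor at least `r`, up to the tiles that cross the boundary of `B`. -/
lemma mul_card_tiles_le {G ι : Type*} [Group G] [Fintype ι] (E E' : ι → Finset G)
    (honeE : ∀ i, (1 : G) ∈ E i) (hsub : ∀ i, E' i ⊆ E i) (C : ι → Set G)
    (hdisj : ∀ (i : ι), ∀ c ∈ C i, ∀ (j : ι), ∀ d ∈ C j, (i, c) ≠ (j, d) →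
      Disjoint ((E i).image (· * c)) ((E j).image (· * d)))
    {r : ℝ} (hr : 0 ≤ r) (hE' : ∀ i, r * ((E i).card : ℝ) ≤ ((E' i).card : ℝ)) (B : Finset G) :
    r * ((B.filter (fun b => b ∈ ⋃ i, ⋃ c ∈ C i, ((E i).image (· * c) : Set G))).card -
        ∑ t ∈ Finset.univ.biUnion (fun i => E i / E i), ((exitSet B t).card : ℝ)) ≤
      (B.filter (fun b => b ∈ ⋃ i, ⋃ c ∈ C i, ((E' i).image (· * c) : Set G))).card := by
  set T : Finset G := Finset.univ.biUnion (fun i => E i / E i)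
  set P : Finset (ι × G) := (Finset.univ ×ˢ B).filter
    (fun p => p.2 ∈ C p.1 ∧ (E p.1).image (· * p.2) ⊆ B)
  have hcover : (B.filter (fun b => b ∈ ⋃ i, ⋃ c ∈ C i, ((E i).image (· * c) : Set G))).card ≤
      ∑ p ∈ P, (E p.1).card + ∑ t ∈ T, (exitSet B t).card := by
    have hsubset : B.filter (fun b => b ∈ ⋃ i, ⋃ c ∈ C i, ((E i).image (· * c) : Set G)) ⊆
        P.biUnion (fun p => (E p.1).image (· * p.2)) ∪ T.biUnion (exitSet B) := by
      intro b hb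
      obtain ⟨hbB, hbH⟩ := Finset.mem_filter.1 hb
      simp only [Set.mem_iUnion, Finset.mem_coe] at hbH
      obtain ⟨i, c, hc, hbc⟩ := hbH
      by_cases hin : (E i).image (· * c) ⊆ B
      · refine Finset.mem_union_left _ (Finset.mem_biUnion.2 ⟨(i, c), ?_, hbc⟩)
        have hcB : c ∈ B := hin (Finset.mem_image.2 ⟨1, honeE i, one_mul c⟩)
        exact Finset.mem_filter.2 ⟨Finset.mk_mem_product (Finset.mem_univ i) hcB, hc, hin⟩
      · obtain ⟨x, hx, hxB⟩ := Finset.not_subset.1 hin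
        obtain ⟨u, hu, rfl⟩ := Finset.mem_image.1 hx
        obtain ⟨v, hv, rfl⟩ := Finset.mem_image.1 hbc
        refine Finset.mem_union_right _ (Finset.mem_biUnion.2 ⟨u / v, ?_, ?_⟩)
        · exact Finset.mem_biUnion.2 ⟨i, Finset.mem_univ i, Finset.div_mem_div hu hv⟩
        · refine Finset.mem_filter.2 ⟨hbB, ?_⟩
          simpa [div_eq_mul_inv, mul_assoc] using hxB
    refine (Finset.card_le_card hsubset).trans ((Finset.card_union_le _ _).trans
      (add_le_add (Finset.card_biUnion_le.trans ?_) Finset.card_biUnion_le))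
    exact Finset.sum_le_sum fun p _ => Finset.card_image_le
  have hinner : ∑ p ∈ P, (E' p.1).card ≤
      (B.filter (fun b => b ∈ ⋃ i, ⋃ c ∈ C i, ((E' i).image (· * c) : Set G))).card := by
    have hcard : (P.biUnion (fun p => (E' p.1).image (· * p.2))).card =
        ∑ p ∈ P, (E' p.1).card := by
      rw [Finset.card_biUnion]
      · exact Finset.sum_congr rfl fun p _ =>
          Finset.card_image_of_injective _ (mul_left_injective p.2)
      · intro p hp q hq hpq
        refine Disjoint.mono (Finset.image_subset_image (hsub p.1))
          (Finset.image_subset_image (hsub q.1)) ?_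
        exact hdisj p.1 p.2 (Finset.mem_filter.1 hp).2.1 q.1 q.2 (Finset.mem_filter.1 hq).2.1 hpq
    rw [← hcard]
    apply Finset.card_le_card
    intro b hb
    obtain ⟨p, hp, hbp⟩ := Finset.mem_biUnion.1 hb
    obtain ⟨hpC, hpB⟩ := (Finset.mem_filter.1 hp).2
    refine Finset.mem_filter.2 ⟨hpB (Finset.image_subset_image (hsub p.1) hbp), ?_⟩
    simp only [Set.mem_iUnion, Finset.mem_coe]
    exact ⟨p.1, p.2, hpC, hbp⟩
  have hscale : r * ∑ p ∈ P, ((E p.1).card : ℝ) ≤ ∑ p ∈ P, ((E' p.1).card : ℝ) := by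
    rw [Finset.mul_sum]
    exact Finset.sum_le_sum fun p _ => hE' p.1
  have hcover' : ((B.filter
      (fun b => b ∈ ⋃ i, ⋃ c ∈ C i, ((E i).image (· * c) : Set G))).card : ℝ) ≤
      ∑ p ∈ P, ((E p.1).card : ℝ) + ∑ t ∈ T, ((exitSet B t).card : ℝ) := by
    exact_mod_cast hcover
  refine (mul_le_mul_of_nonneg_left (sub_le_iff_le_add.2 hcover') hr).trans (hscale.trans ?_)
  exact_mod_cast hinner

/-- Shrinking disjoint tiles by a factor at least `r` shrinks the lower Banach density of their
union by a factor at least `r`. -/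
lemma mul_banachDensity_tiles_le {G ι : Type*} [Group G] [Fintype ι] {Fo : ℕ → Finset G}
    (hFo : IsFolnerSeq Fo) (E E' : ι → Finset G)
    (honeE : ∀ i, (1 : G) ∈ E i) (hsub : ∀ i, E' i ⊆ E i) (C : ι → Set G)
    (hdisj : ∀ (i : ι), ∀ c ∈ C i, ∀ (j : ι), ∀ d ∈ C j, (i, c) ≠ (j, d) →
      Disjoint ((E i).image (· * c)) ((E j).image (· * d)))
    {r : ℝ} (hr : 0 < r) (hE' : ∀ i, r * ((E i).card : ℝ) ≤ ((E' i).card : ℝ)) :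
    r * banachDensity (⋃ i, ⋃ c ∈ C i, ((E i).image (· * c) : Set G)) ≤
      banachDensity (⋃ i, ⋃ c ∈ C i, ((E' i).image (· * c) : Set G)) := by
  have htiles := mul_card_tiles_le E E' honeE hsub C hdisj hr.le hE'
  set H : Set G := ⋃ i, ⋃ c ∈ C i, ((E i).image (· * c) : Set G)
  set H' : Set G := ⋃ i, ⋃ c ∈ C i, ((E' i).image (· * c) : Set G)
  set T : Finset G := Finset.univ.biUnion (fun i => E i / E i)
  rw [← le_div_iff₀' hr]
  refine banachDensity_le fun F hF => ?_
  rw [le_div_iff₀' hr]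
  refine le_of_forall_pos_le_add fun ε hε => ?_
  have hδ : 0 < ε / (2 * r) := by positivity
  obtain ⟨n, hnF, hnT⟩ := ((hFo.eventually_sum_card_exitSet_le F hδ).and
    (hFo.eventually_sum_card_exitSet_le T hδ)).exists
  have hpos : (0 : ℝ) < (Fo n).card := by exact_mod_cast (hFo.1 n).card_pos
  rw [← sub_le_iff_le_add]
  refine le_trans (le_lowerDF (Fo n) H' fun g => ?_) (lowerDF_le_banachDensity (hFo.1 n) H')
  rw [le_div_iff₀ hpos]
  have hwindow : ∀ S : Set G, (((Fo n).image (· * g)).filter (fun b => b ∈ S)).card =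
      ((Fo n).filter (fun a => a * g ∈ S)).card := fun S => by
    rw [Finset.filter_image, Finset.card_image_of_injective _ (mul_left_injective g)]
  have htile := htiles ((Fo n).image (· * g))
  simp only [card_exitSet_image_mul_right, hwindow] at htile
  have havg := lowerDF_mul_card_le hF (Fo n) H g
  refine le_trans ?_ htile
  have hε' : ε = r * (2 * (ε / (2 * r))) := by field_simp
  calc (r * lowerDF F H - ε) * (Fo n).card
      = r * (lowerDF F H * (Fo n).card - 2 * (ε / (2 * r) * (Fo n).card)) := by
        nth_rewrite 1 [hε']
        ring
    _ ≤ _ := mul_le_mul_of_nonneg_left (by linarith) hr.le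

/-- **Density of unions of shrunken tiles.** Let `G` be a countable amenable group, let
`E 0 ⊆ ⋯ ⊆ E (k-1)` be finite sets containing `1`, and let `C i ⊆ G` be such that the
tiles `(E i) c`, `c ∈ C i`, are pairwise disjoint. If `E' i ⊆ E i` with
`|E' i| > (1-γ)|E i|` for each `i`, then the lower Banach densities of
`E = ⋃ᵢ (E i)(C i)` and `E' = ⋃ᵢ (E' i)(C i)` satisfy `D(E) - D(E') < γ`; in fact
`D(E') ≥ (1-γ) D(E)`. -/
theorem banachDensity_of_shrunken_tiles
    {G : Type*} [Group G] [Countable G]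
    (Fo : ℕ → Finset G) (hFo : IsFolnerSeq Fo) (hone : ∀ n, (1 : G) ∈ Fo n)
    (k : ℕ) (hk : 0 < k) (E : Fin k → Finset G) (hmono : Monotone E)
    (honeE : ∀ i, (1 : G) ∈ E i)
    (C : Fin k → Set G)
    (hdisj : ∀ (i : Fin k), ∀ c ∈ C i, ∀ (j : Fin k), ∀ d ∈ C j, (i, c) ≠ (j, d) →
      Disjoint ((E i).image (· * c)) ((E j).image (· * d)))
    (γ : ℝ) (hγ0 : 0 < γ) (hγ1 : γ < 1)
    (E' : Fin k → Finset G) (hsub : ∀ i, E' i ⊆ E i)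
    (hbig : ∀ i, (1 - γ) * ((E i).card : ℝ) < ((E' i).card : ℝ)) :
    banachDensity (⋃ i : Fin k, ⋃ c ∈ C i, ((E i).image (· * c) : Set G)) -
        banachDensity (⋃ i : Fin k, ⋃ c ∈ C i, ((E' i).image (· * c) : Set G)) < γ ∧
      (1 - γ) * banachDensity (⋃ i : Fin k, ⋃ c ∈ C i, ((E i).image (· * c) : Set G)) ≤
        banachDensity (⋃ i : Fin k, ⋃ c ∈ C i, ((E' i).image (· * c) : Set G)) := by
  have hgap : ∃ δ : ℝ, δ < γ ∧ 0 < δ ∧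
      ∀ i, (1 - δ) * ((E i).card : ℝ) < ((E' i).card : ℝ) := by
    have hev : ∀ᶠ δ in nhdsWithin γ (Set.Iio γ),
        ∀ i, (1 - δ) * ((E i).card : ℝ) < ((E' i).card : ℝ) := by
      refine nhdsWithin_le_nhds (eventually_all.2 fun i => ?_)
      have hcont : Continuous fun δ : ℝ => (1 - δ) * ((E i).card : ℝ) := by fun_prop
      exact hcont.continuousAt.eventually_lt continuousAt_const (hbig i)
    have hpos : ∀ᶠ δ in nhdsWithin γ (Set.Iio γ), 0 < δ :=
      nhdsWithin_le_nhds (lt_mem_nhds hγ0)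
    exact (eventually_mem_nhdsWithin.and (hpos.and hev)).exists
  obtain ⟨δ, hδγ, hδ0, hδ⟩ := hgap
  refine ⟨?_, mul_banachDensity_tiles_le hFo E E' honeE hsub C hdisj (by linarith)
    fun i => (hbig i).le⟩
  have hmul := mul_banachDensity_tiles_le hFo E E' honeE hsub C hdisj (r := 1 - δ) (by linarith)
    fun i => (hδ i).le
  have hle : banachDensity (⋃ i : Fin k, ⋃ c ∈ C i, ((E i).image (· * c) : Set G)) ≤ 1 :=
    banachDensity_le fun F _ => lowerDF_le_one F _
  nlinarith [mul_le_mul_of_nonneg_left hle hδ0.le]
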